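/- arXiv:2406.15856 — 4 statements merged into one kernel-verified Lean document; each statement's English description precedes it below -/
import Mathlib

section
/- Let Φ = (φ_1,…,φ_m) be a finite family of nonzero vectors in ℝ^n, α ∈ ℝ^m, and ∅ ≠ K ⊆ ℝ^n. If Φ is α-rectifying on K and K is open or K is convex, then the ReLU layer C_α is injective on K. -/
open scoped RealInnerProductSpace

noncomputable section

/-- Euclidean space `ℝ^n`. -/
abbrev Euc (n : ℕ) : Type := EuclideanSpace ℝ (Fin n)

/-- The active index set `I_x^α = {i : ⟨x, φ i⟩ ≥ α i}`. -/
def activeSet {n m : ℕ} (φ : Fin m → Euc n) (α : Fin m → ℝ) (x : Euc n) : Set (Fin m) :=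
  {i | α i ≤ ⟪x, φ i⟫}

/-- `Φ` is `α`-rectifying on `K` if for every `x ∈ K` the active subfamily spans `ℝ^n`. -/
def IsRectifying {n m : ℕ} (φ : Fin m → Euc n) (α : Fin m → ℝ) (K : Set (Euc n)) : Prop :=
  ∀ x ∈ K, Submodule.span ℝ (φ '' activeSet φ α x) = ⊤

/-- The ReLU layer `(C_α x)_i = max (0, ⟨x, φ i⟩ - α i)`. -/
def reluLayer {n m : ℕ} (φ : Fin m → Euc n) (α : Fin m → ℝ) (x : Euc n) :
    EuclideanSpace ℝ (Fin m) :=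
  WithLp.toLp 2 fun i => max 0 (⟪x, φ i⟫ - α i)

theorem stmt_1 {n m : ℕ} (φ : Fin m → Euc n) (hφ : ∀ i, φ i ≠ 0) (hmn : n ≤ m)
    (α : Fin m → ℝ) (K : Set (Euc n)) (hK : K.Nonempty)
    (hrect : IsRectifying φ α K) (hKoc : IsOpen K ∨ Convex ℝ K) :
    Set.InjOn (reluLayer φ α) K := by
  intro x hx y hy hxy
  obtain ⟨t, ht0, ht1, htK⟩ : ∃ t : ℝ, 0 < t ∧ t < 1 ∧ (1 - t) • x + t • y ∈ K := by
    rcases hKoc with ho | hc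
    · have hcont : Continuous fun t : ℝ => (1 - t) • x + t • y := by fun_prop
      have hmem : (fun t : ℝ => (1 - t) • x + t • y) ⁻¹' K ∈ nhds (0 : ℝ) :=
        (ho.preimage hcont).mem_nhds (by simpa using hx)
      obtain ⟨ε, hε, hball⟩ := Metric.mem_nhds_iff.1 hmem
      refine ⟨min (ε / 2) (1 / 2), by positivity, ?_, ?_⟩
      · exact lt_of_le_of_lt (min_le_right _ _) (by norm_num)
      · have hp : 0 < min (ε / 2) (1 / 2) := by positivity
        have hlt : min (ε / 2) (1 / 2) < ε := lt_of_le_of_lt (min_le_left _ _) (by linarith)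
        have := @hball (min (ε / 2) (1 / 2)) (by
          rw [Metric.mem_ball, Real.dist_eq, sub_zero, abs_of_pos hp]
          exact hlt)
        exact this
    · exact ⟨1 / 2, by norm_num, by norm_num,
        hc hx hy (by norm_num) (by norm_num) (by norm_num)⟩
  have hspan := hrect _ htK
  have hle : Submodule.span ℝ (φ '' activeSet φ α ((1 - t) • x + t • y)) ≤
      LinearMap.ker (innerₛₗ ℝ (x - y)) := by
    rw [Submodule.span_le]
    rintro _ ⟨i, hi, rfl⟩
    have hi' : α i ≤ (1 - t) * ⟪x, φ i⟫ + t * ⟪y, φ i⟫ := by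
      have h : α i ≤ ⟪(1 - t) • x + t • y, φ i⟫ := hi
      rwa [inner_add_left, real_inner_smul_left, real_inner_smul_left] at h
    have he : max 0 (⟪x, φ i⟫ - α i) = max 0 (⟪y, φ i⟫ - α i) :=
      congrArg (fun v : EuclideanSpace ℝ (Fin m) => v i) hxy
    have hgoal : ⟪x - y, φ i⟫ = 0 := by
      rw [inner_sub_left]
      generalize ⟪x, φ i⟫ = a at *
      generalize ⟪y, φ i⟫ = b at *
      rcases le_total (a - α i) 0 with h1 | h1 <;> rcases le_total (b - α i) 0 with h2 | h2 <;>
        simp only [h1, h2, max_eq_left, max_eq_right] at he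
      · have ha : a = α i := by nlinarith
        have hb : b = α i := by nlinarith
        linarith
      · have ha : a = α i := by nlinarith
        linarith
      · have hb : b = α i := by nlinarith
        linarith
      · linarith
    exact LinearMap.mem_ker.2 hgoal
  rw [hspan] at hle
  have h0 : ⟪x - y, x - y⟫ = 0 := by
    have := hle (Submodule.mem_top (x := x - y))
    rw [LinearMap.mem_ker] at this
    exact this
  exact sub_eq_zero.1 (inner_self_eq_zero.1 h0)
end
end

section
/- Let Φ = (φ_1,…,φ_m) be α-rectifying on a bounded set K ⊆ ℝ^n, set M = sup_{x∈K} ‖x‖, and suppose A > 0 is a common lower frame bound for all active subfamilies, i.e., A·‖z‖² ≤ Σ_{i∈I_x^α} ⟨z,φ_i⟩² for all x ∈ K and z ∈ ℝ^n. Let ε > 0 satisfy ε²·m < A, and let Φ' = (φ'_1,…,φ'_m) be any family with ‖φ_i − φ'_i‖ ≤ ε for all i. Then Φ' is α'-rectifying on K, where α'_i = α_i − ε·M for each i. -/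
open scoped RealInnerProductSpace

noncomputable section

theorem stmt_6 {n m : ℕ} (φ : Fin m → Euc n) (hφ : ∀ i, φ i ≠ 0) (hmn : n ≤ m)
    (α : Fin m → ℝ) (K : Set (Euc n)) (hK : Bornology.IsBounded K)
    (hrect : IsRectifying φ α K)
    (M : ℝ) (hM : M = sSup ((fun x => ‖x‖) '' K))
    (A : ℝ) (hA : 0 < A)
    (hlow : ∀ x ∈ K, ∀ z : Euc n,
      A * ‖z‖ ^ 2 ≤ ∑ i, if α i ≤ ⟪x, φ i⟫ then ⟪z, φ i⟫ ^ 2 else 0)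
    (ε : ℝ) (hε : 0 < ε) (hεA : ε ^ 2 * m < A)
    (φ' : Fin m → Euc n) (hφ' : ∀ i, ‖φ i - φ' i‖ ≤ ε) :
    IsRectifying φ' (fun i => α i - ε * M) K := by
  intro x hx
  have hxM : ‖x‖ ≤ M := by
    rw [hM]
    obtain ⟨C, hC⟩ := hK.exists_norm_le
    refine le_csSup ⟨C, ?_⟩ ⟨x, hx, rfl⟩
    rintro _ ⟨y, hy, rfl⟩
    exact hC y hy
  rw [← Submodule.orthogonal_eq_bot_iff, Submodule.eq_bot_iff]
  intro z hz
  rw [Submodule.mem_orthogonal'] at hz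
  have key : ∀ i, (if α i ≤ ⟪x, φ i⟫ then ⟪z, φ i⟫ ^ 2 else 0) ≤ ε ^ 2 * ‖z‖ ^ 2 := by
    intro i
    split_ifs with h
    · have hact : i ∈ activeSet φ' (fun i => α i - ε * M) x := by
        change α i - ε * M ≤ ⟪x, φ' i⟫
        have h1 : ⟪x, φ i - φ' i⟫ ≤ ‖x‖ * ‖φ i - φ' i‖ := real_inner_le_norm _ _
        have h2 : ‖x‖ * ‖φ i - φ' i‖ ≤ M * ε :=
          mul_le_mul hxM (hφ' i) (norm_nonneg _) ((norm_nonneg _).trans hxM)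
        rw [inner_sub_right] at h1
        linarith
      have h0 : ⟪z, φ' i⟫ = 0 := hz _ (Submodule.subset_span ⟨i, hact, rfl⟩)
      have h3 : ⟪z, φ i⟫ = ⟪z, φ i - φ' i⟫ := by rw [inner_sub_right, h0, sub_zero]
      have h4 : |⟪z, φ i⟫| ≤ ε * ‖z‖ := by
        rw [h3]
        refine (abs_real_inner_le_norm _ _).trans ?_
        rw [mul_comm]
        exact mul_le_mul_of_nonneg_right (hφ' i) (norm_nonneg _)
      rw [← mul_pow, ← sq_abs]
      exact pow_le_pow_left₀ (abs_nonneg _) h4 2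
    · positivity
  have hsum := (hlow x hx z).trans (Finset.sum_le_sum fun i _ => key i)
  simp only [Finset.sum_const, Finset.card_univ, Fintype.card_fin, nsmul_eq_mul] at hsum
  by_contra hne
  have hpos : 0 < ‖z‖ ^ 2 := by
    have := norm_pos_iff.mpr hne
    positivity
  have := mul_lt_mul_of_pos_right hεA hpos
  linarith
end
end

section
/- Let Φ = (φ_1,…,φ_m) be a finite family of nonzero vectors in ℝ^n and α ∈ ℝ^m. If Φ is α-rectifying on all of ℝ^n, then m ≥ 2n (i.e., the frame has redundancy at least two). -/
open scoped RealInnerProductSpace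

noncomputable section

theorem exists_generic_aux {n m : ℕ} (φ : Fin m → Euc n) (hφ : ∀ i, φ i ≠ 0) :
    ∃ v : Euc n, ∀ i, ⟪v, φ i⟫ ≠ 0 := by
  obtain ⟨f, hf⟩ := Module.exists_dual_forall_apply_ne_zero (K := ℝ) φ hφ
  refine ⟨(InnerProductSpace.toDual ℝ (Euc n)).symm (LinearMap.toContinuousLinearMap f), ?_⟩
  intro i
  rw [InnerProductSpace.toDual_symm_apply]
  exact hf i

theorem ncard_active_aux {n m : ℕ} (φ : Fin m → Euc n) (S : Set (Fin m))
    (h : Submodule.span ℝ (φ '' S) = ⊤) : n ≤ S.ncard := by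
  classical
  have h1 := finrank_span_finset_le_card (R := ℝ) (S.toFinset.image φ)
  have h2 : ((S.toFinset.image φ : Finset (Euc n)) : Set (Euc n)) = φ '' S := by simp
  unfold Set.finrank at h1
  rw [h2, h, finrank_top, finrank_euclideanSpace_fin] at h1
  rw [Set.ncard_eq_toFinset_card']
  exact h1.trans Finset.card_image_le

theorem stmt_7 {n m : ℕ} (φ : Fin m → Euc n) (hφ : ∀ i, φ i ≠ 0)
    (α : Fin m → ℝ) (hrect : IsRectifying φ α Set.univ) :
    2 * n ≤ m := by
  obtain ⟨v, hv⟩ := exists_generic_aux φ hφ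
  have ht' : ∀ᶠ t : ℝ in Filter.atTop, ∀ i, |α i| < t * |⟪v, φ i⟫| := by
    rw [Filter.eventually_all]
    intro i
    exact (Filter.tendsto_id.atTop_mul_const (abs_pos.mpr (hv i))).eventually_gt_atTop _
  obtain ⟨t, ht⟩ := ht'.exists
  have h1 := ncard_active_aux φ _ (hrect (t • v) (Set.mem_univ _))
  have h2 := ncard_active_aux φ _ (hrect (-(t • v)) (Set.mem_univ _))
  have hd : Disjoint (activeSet φ α (t • v)) (activeSet φ α (-(t • v))) := by
    rw [Set.disjoint_left]
    intro i hi hj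
    simp only [activeSet, Set.mem_setOf_eq, inner_neg_left, real_inner_smul_left] at hi hj
    have h3 := ht i
    have h4 := neg_abs_le (α i)
    rcases abs_cases ⟪v, φ i⟫ with ⟨h, -⟩ | ⟨h, -⟩ <;> rw [h] at h3 <;> linarith
  have h3 := Set.ncard_union_eq hd
  have h4 := Set.ncard_le_card (activeSet φ α (t • v) ∪ activeSet φ α (-(t • v)))
  simp only [Nat.card_eq_fintype_card, Fintype.card_fin] at h4
  omega
end
end

section
/- Let Φ = (φ_1,…,φ_m) be a finite family of nonzero vectors in ℝ^n, α ∈ ℝ^m, and let O ⊆ ℝ^n be open or convex. Suppose that for every x ∈ O there exists J ⊆ {1,…,m} such that (φ_j)_{j∈J} is a basis of ℝ^n and ⟨x,φ_j⟩ ≥ α_j for all j ∈ J (i.e., O is contained in the maximal domain K*_α). Then for every nonempty K ⊆ O on which Φ is α-rectifying, the ReLU layer C_α is injective on K. -/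
open scoped RealInnerProductSpace

noncomputable section

/-- `(φ i)_{i ∈ J}` is a basis of `ℝ^n`: linearly independent and spanning. -/
def IsBasisIndex {n m : ℕ} (φ : Fin m → Euc n) (J : Set (Fin m)) : Prop :=
  LinearIndependent ℝ (fun i : J => φ (i : Fin m)) ∧ Submodule.span ℝ (φ '' J) = ⊤


theorem stmt_11 {n m : ℕ} (φ : Fin m → Euc n) (hφ : ∀ i, φ i ≠ 0) (hmn : n ≤ m)
    (α : Fin m → ℝ) (O : Set (Euc n)) (hOoc : IsOpen O ∨ Convex ℝ O)
    (hOmax : ∀ x ∈ O, ∃ J : Set (Fin m), IsBasisIndex φ J ∧ ∀ j ∈ J, α j ≤ ⟪x, φ j⟫)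
    (K : Set (Euc n)) (hKne : K.Nonempty) (hKO : K ⊆ O)
    (hrect : IsRectifying φ α K) :
    Set.InjOn (reluLayer φ α) K := by
  intro x hx y hy hxy
  have hcoord : ∀ i, max 0 (⟪x, φ i⟫ - α i) = max 0 (⟪y, φ i⟫ - α i) := by
    intro i
    exact congrArg (fun v : EuclideanSpace ℝ (Fin m) => v i) hxy
  -- an interior point of the segment lying in `O`
  have hpt : ∃ t : ℝ, 0 < t ∧ t < 1 ∧ (1 - t) • x + t • y ∈ O := by
    rcases hOoc with hO | hO
    · have hc : Continuous (fun t : ℝ => (1 - t) • x + t • y) := by fun_prop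
      have hn : (fun t : ℝ => (1 - t) • x + t • y) ⁻¹' O ∈ nhds (0 : ℝ) := by
        apply (hO.preimage hc).mem_nhds
        simpa using hKO hx
      obtain ⟨ε, hε, hb⟩ := Metric.mem_nhds_iff.1 hn
      refine ⟨min (ε / 2) (1 / 2), by positivity, ?_, ?_⟩
      · exact lt_of_le_of_lt (min_le_right _ _) (by norm_num)
      · apply hb
        have hp : 0 < min (ε / 2) (1 / 2) := by positivity
        rw [Metric.mem_ball, Real.dist_eq, sub_zero, abs_of_pos hp]
        exact lt_of_le_of_lt (min_le_left _ _) (by linarith)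
    · exact ⟨1 / 2, by norm_num, by norm_num,
        hO (hKO hx) (hKO hy) (by norm_num) (by norm_num) (by norm_num)⟩
  obtain ⟨t, ht0, ht1, htO⟩ := hpt
  obtain ⟨J, ⟨-, hspan⟩, hJ⟩ := hOmax _ htO
  have heq : ∀ j ∈ J, ⟪x, φ j⟫ = ⟪y, φ j⟫ := by
    intro j hj
    have h1 := hJ j hj
    rw [inner_add_left, real_inner_smul_left, real_inner_smul_left] at h1
    have h2 := hcoord j
    generalize ⟪x, φ j⟫ = a at *
    generalize ⟪y, φ j⟫ = b at *
    rcases le_total 0 (a - α j) with ha | ha <;> rcases le_total 0 (b - α j) with hb | hb <;>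
      simp only [max_eq_left, max_eq_right, ha, hb] at h2 <;> nlinarith
  have hle : Submodule.span ℝ (φ '' J) ≤ (ℝ ∙ (x - y))ᗮ := by
    rw [Submodule.span_le]
    rintro _ ⟨j, hj, rfl⟩
    rw [SetLike.mem_coe, Submodule.mem_orthogonal_singleton_iff_inner_right, inner_sub_left,
      heq j hj, sub_self]
  rw [hspan] at hle
  have hz := hle (Submodule.mem_top : x - y ∈ ⊤)
  rw [Submodule.mem_orthogonal_singleton_iff_inner_right, inner_self_eq_zero] at hz
  exact sub_eq_zero.1 hz
end
end
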